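/- arXiv:1603.05075 — 8 statements merged into one kernel-verified Lean document; each statement's English description precedes it below -/
import Mathlib

section
/- For any finite simple graph G on n vertices with adjacency matrix A and any nonnegative weight vector w ∈ ℝ^n, the weighted independence number of G equals the maximum of wᵀx over all vectors x ∈ ℝ^n that solve LCP(A+I, −e); that is, α_w(G) = max{ wᵀx : x ≥ 0, (A+I)x ≥ e, xᵀ((A+I)x − e) = 0 }. -/
open Matrix Finset

/-- `x` solves the linear complementarity problem `LCP(A + I, -e)`, where `A` is the
adjacency matrix of the simple graph `G`, `I` is the identity matrix and `e` is the
all-ones vector: `x ≥ 0`, `(A+I)x ≥ e`, and `xᵀ((A+I)x − e) = 0`. -/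
def SolLCP {V : Type*} [Fintype V] [DecidableEq V] (G : SimpleGraph V) [DecidableRel G.Adj]
    (x : V → ℝ) : Prop :=
  (∀ i, 0 ≤ x i) ∧
  (∀ i, 1 ≤ ((G.adjMatrix ℝ + 1) *ᵥ x) i) ∧
  ∑ i, x i * (((G.adjMatrix ℝ + 1) *ᵥ x) i - 1) = 0

/-- `S` is an independent set of the simple graph `G`: its vertices are pairwise nonadjacent. -/
def IsIndepFinset {V : Type*} (G : SimpleGraph V) (S : Finset V) : Prop :=
  ∀ i ∈ S, ∀ j ∈ S, ¬ G.Adj i j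

/-- `S` is a maximal independent set of `G`: it is independent and is not properly
contained in any larger independent set. -/
def IsMaxIndepFinset {V : Type*} (G : SimpleGraph V) (S : Finset V) : Prop :=
  IsIndepFinset G S ∧ ∀ T : Finset V, IsIndepFinset G T → S ⊆ T → S = T

/-- The `i`-th coordinate of `(A + I)x` is the sum of `x` over the closed neighbourhood of `i`. -/
theorem adjMatrix_add_one_mulVec {V : Type*} [Fintype V] [DecidableEq V] (G : SimpleGraph V)
    [DecidableRel G.Adj] (x : V → ℝ) (i : V) :
    ((G.adjMatrix ℝ + 1) *ᵥ x) i = ∑ j with j = i ∨ G.Adj i j, x j := by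
  rw [Matrix.add_mulVec, Pi.add_apply, Matrix.one_mulVec, SimpleGraph.adjMatrix_mulVec_apply,
    SimpleGraph.neighborFinset_eq_filter, Finset.filter_or, Finset.sum_union, add_comm]
  · simp [Finset.filter_eq']
  · rw [Finset.disjoint_filter]
    rintro j - rfl
    exact G.irrefl

/-- If the positive weights `x` on `σ` sum to at most `1` over every closed neighbourhood in `σ`,
then some independent subset of `σ` has `w`-weight at least `∑ i ∈ σ, w i * x i`. -/
theorem exists_isIndepFinset_sum_le {V : Type*} [DecidableEq V] (G : SimpleGraph V)
    [DecidableRel G.Adj] (w x : V → ℝ) (hw : ∀ i, 0 ≤ w i) (σ : Finset V)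
    (hx : ∀ i ∈ σ, 0 < x i) (hd : ∀ i ∈ σ, ∑ j ∈ σ with j = i ∨ G.Adj i j, x j ≤ 1) :
    ∃ S ⊆ σ, IsIndepFinset G S ∧ ∑ i ∈ σ, w i * x i ≤ ∑ i ∈ S, w i := by
  induction σ using Finset.strongInduction with
  | H σ ih =>
  rcases σ.eq_empty_or_nonempty with rfl | hne
  · exact ⟨∅, subset_rfl, by simp [IsIndepFinset], by simp⟩
  obtain ⟨v, hv, hwv⟩ : ∃ v ∈ σ, ∑ j ∈ σ with j = v ∨ G.Adj v j, w j * x j ≤ w v := by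
    by_contra! h
    have hlt : ∑ v ∈ σ, x v * w v <
        ∑ v ∈ σ, x v * ∑ j ∈ σ with j = v ∨ G.Adj v j, w j * x j :=
      Finset.sum_lt_sum_of_nonempty hne fun v hv => mul_lt_mul_of_pos_left (h v hv) (hx v hv)
    have hswap : ∑ v ∈ σ, x v * ∑ j ∈ σ with j = v ∨ G.Adj v j, w j * x j =
        ∑ j ∈ σ, (w j * x j) * ∑ v ∈ σ with v = j ∨ G.Adj j v, x v := by
      simp only [Finset.mul_sum, Finset.sum_filter]
      rw [Finset.sum_comm]
      refine Finset.sum_congr rfl fun j _ => Finset.sum_congr rfl fun v _ => ?_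
      simp only [eq_comm (a := j), G.adj_comm v j, mul_comm (x v), ite_mul, mul_ite, zero_mul, mul_zero]
    have hle : ∑ j ∈ σ, (w j * x j) * ∑ v ∈ σ with v = j ∨ G.Adj j v, x v ≤
        ∑ j ∈ σ, x j * w j := by
      refine Finset.sum_le_sum fun j hj => ?_
      rw [mul_comm (x j)]
      exact mul_le_of_le_one_right (mul_nonneg (hw j) (hx j hj).le) (hd j hj)
    linarith
  have hsub : {j ∈ σ | ¬(j = v ∨ G.Adj v j)} ⊆ σ := Finset.filter_subset _ _
  obtain ⟨S, hSσ, hS, hsum⟩ := ih {j ∈ σ | ¬(j = v ∨ G.Adj v j)}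
    (Finset.filter_ssubset.2 ⟨v, hv, by simp⟩) (fun i hi => hx i (hsub hi))
    (fun i hi => (Finset.sum_le_sum_of_subset_of_nonneg (Finset.filter_subset_filter _ hsub)
      fun j hj _ => (hx j (Finset.mem_filter.1 hj).1).le).trans (hd i (hsub hi)))
  have hSv : ∀ j ∈ S, ¬(j = v ∨ G.Adj v j) := fun j hj => (Finset.mem_filter.1 (hSσ hj)).2
  have hvS : v ∉ S := fun h => hSv v h (Or.inl rfl)
  refine ⟨insert v S, Finset.insert_subset hv (hSσ.trans hsub), ?_, ?_⟩
  · intro i hi j hj hij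
    rcases Finset.mem_insert.1 hi with rfl | hiS <;> rcases Finset.mem_insert.1 hj with rfl | hjS
    · exact G.irrefl hij
    · exact hSv j hjS (Or.inr hij)
    · exact hSv i hiS (Or.inr hij.symm)
    · exact hS i hiS j hjS hij
  · rw [Finset.sum_insert hvS,
      ← Finset.sum_filter_add_sum_filter_not σ (fun j => j = v ∨ G.Adj v j)]
    exact add_le_add hwv hsum

/-- Every independent set of a finite graph extends to a maximal one. -/
theorem IsIndepFinset.exists_isMaxIndepFinset {V : Type*} [Finite V] {G : SimpleGraph V}
    {S : Finset V} (hS : IsIndepFinset G S) : ∃ T, S ⊆ T ∧ IsMaxIndepFinset G T := by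
  obtain ⟨T, hST, hT⟩ := (Set.toFinite {T | IsIndepFinset G T}).exists_le_maximal hS
  exact ⟨T, hST, hT.prop, fun U hU hTU => hT.eq_of_le hU hTU⟩

/-- A vertex outside a maximal independent set has a neighbour in it. -/
theorem IsMaxIndepFinset.exists_adj {V : Type*} [DecidableEq V] {G : SimpleGraph V}
    {T : Finset V} (hT : IsMaxIndepFinset G T) {i : V} (hi : i ∉ T) : ∃ j ∈ T, G.Adj i j := by
  by_contra! h
  refine hi ((hT.2 (insert i T) ?_ (Finset.subset_insert i T)) ▸ Finset.mem_insert_self i T)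
  intro a ha b hb hab
  rcases Finset.mem_insert.1 ha with rfl | haT <;> rcases Finset.mem_insert.1 hb with rfl | hbT
  · exact G.irrefl hab
  · exact h b hbT hab
  · exact h a haT hab.symm
  · exact hT.1 a haT b hbT hab

/-- The indicator vector of a maximal independent set solves `LCP(A + I, -e)`. -/
theorem IsMaxIndepFinset.solLCP {V : Type*} [Fintype V] [DecidableEq V] {G : SimpleGraph V}
    [DecidableRel G.Adj] {T : Finset V} (hT : IsMaxIndepFinset G T) :
    SolLCP G fun i => if i ∈ T then 1 else 0 := by
  have hnn : ∀ i, (0 : ℝ) ≤ if i ∈ T then 1 else 0 := fun i => by split_ifs <;> norm_num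
  refine ⟨hnn, fun i => ?_, Finset.sum_eq_zero fun i _ => ?_⟩
  · rw [adjMatrix_add_one_mulVec]
    obtain ⟨j, hjT, hj⟩ : ∃ j ∈ T, j = i ∨ G.Adj i j := by
      by_cases hi : i ∈ T
      · exact ⟨i, hi, Or.inl rfl⟩
      · obtain ⟨j, hj, hij⟩ := hT.exists_adj hi
        exact ⟨j, hj, Or.inr hij⟩
    calc (1 : ℝ) = if j ∈ T then 1 else 0 := (if_pos hjT).symm
      _ ≤ _ := Finset.single_le_sum (f := fun j => if j ∈ T then (1 : ℝ) else 0)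
        (fun k _ => hnn k) (by simpa using hj)
  · by_cases hi : i ∈ T
    · rw [adjMatrix_add_one_mulVec, Finset.sum_eq_single_of_mem i (by simp)]
      · simp [hi]
      · intro j hj hji
        have hij : G.Adj i j := by simpa [hji] using hj
        exact if_neg fun hjT => hT.1 i hi j hjT hij
    · simp [hi]

/-- On the support of a solution of `LCP(A + I, -e)`, the inequality `(A + I)x ≥ e` is tight. -/
theorem SolLCP.mulVec_eq_one {V : Type*} [Fintype V] [DecidableEq V] {G : SimpleGraph V}
    [DecidableRel G.Adj] {x : V → ℝ} (hx : SolLCP G x) {i : V} (hi : 0 < x i) :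
    ((G.adjMatrix ℝ + 1) *ᵥ x) i = 1 := by
  have h := (Finset.sum_eq_zero_iff_of_nonneg fun j _ =>
    mul_nonneg (hx.1 j) (sub_nonneg.2 (hx.2.1 j))).1 hx.2.2 i (Finset.mem_univ i)
  exact sub_eq_zero.1 ((mul_eq_zero.1 h).resolve_left hi.ne')

/-- For any simple graph `G` on `n` vertices and any nonnegative weight vector `w`, the
weighted independence number `α_w(G)` (the maximum of `Σ_{i∈S} w i` over independent
sets `S`) equals the maximum of `wᵀx` over all solutions `x` of `LCP(A+I, -e)`. -/
theorem stmt_0 {n : ℕ} (G : SimpleGraph (Fin n)) [DecidableRel G.Adj]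
    (w : Fin n → ℝ) (hw : ∀ i, 0 ≤ w i) (αw : ℝ)
    (hαw : IsGreatest {v : ℝ | ∃ S : Finset (Fin n), IsIndepFinset G S ∧ v = ∑ i ∈ S, w i} αw) :
    IsGreatest {v : ℝ | ∃ x : Fin n → ℝ, SolLCP G x ∧ v = ∑ i, w i * x i} αw := by
  obtain ⟨⟨S, hS, rfl⟩, hub⟩ := hαw
  constructor
  · obtain ⟨T, hST, hT⟩ := hS.exists_isMaxIndepFinset
    refine ⟨_, hT.solLCP, ?_⟩
    simp only [mul_ite, mul_one, mul_zero, Finset.sum_ite_mem, Finset.univ_inter]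
    exact le_antisymm (Finset.sum_le_sum_of_subset_of_nonneg hST fun i _ _ => hw i)
      (hub ⟨T, hT.1, rfl⟩)
  · rintro _ ⟨x, hx, rfl⟩
    obtain ⟨T, -, hT, hle⟩ := exists_isIndepFinset_sum_le G w x hw {i | 0 < x i} (by simp) <| by
      intro i hi
      rw [← hx.mulVec_eq_one (Finset.mem_filter.1 hi).2, adjMatrix_add_one_mulVec]
      exact Finset.sum_le_sum_of_subset_of_nonneg
        (Finset.filter_subset_filter _ (Finset.subset_univ _)) fun j _ _ => hx.1 j
    rw [Finset.sum_filter_of_ne fun i _ hi =>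
      (hx.1 i).lt_of_ne' (right_ne_zero_of_mul hi)] at hle
    exact hle.trans (hub ⟨T, hT, rfl⟩)
end

section
/- For any finite simple graph G, if x ∈ SOL(G), then the support σ(x) = { i : x_i > 0 } is a dominating set of G, i.e. every vertex not in σ(x) has a neighbour in σ(x). -/
open Matrix Finset

/-- If `x` solves `LCP(G)`, then the support `σ(x) = {i : x i > 0}` is a dominating set
of `G`: every vertex not in `σ(x)` has a neighbour in `σ(x)`. -/
theorem stmt_5 {n : ℕ} (G : SimpleGraph (Fin n)) [DecidableRel G.Adj]
    (x : Fin n → ℝ) (hx : SolLCP G x) :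
    ∀ v : Fin n, v ∉ {i | 0 < x i} → ∃ u ∈ {i | 0 < x i}, G.Adj v u := by
  intro v hv
  by_contra! h
  have hv0 : x v ≤ 0 := by simpa using hv
  have hsum : ∑ u ∈ G.neighborFinset v, x u ≤ 0 := by
    refine Finset.sum_nonpos fun u hu => ?_
    by_contra! hpos
    exact h u (by simpa using hpos) ((G.mem_neighborFinset v u).1 hu)
  have hge := hx.2.1 v
  rw [Matrix.add_mulVec, Matrix.one_mulVec, Pi.add_apply,
    SimpleGraph.adjMatrix_mulVec_apply] at hge
  linarith
end

section
/- For any finite simple graph G on n vertices, a vector x ∈ {0,1}^n solves LCP(G) if and only if x is the characteristic vector of a maximal independent set of G. -/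
open Matrix Finset

theorem isMaxIndepFinset_iff {V : Type*} [DecidableEq V] {G : SimpleGraph V} {S : Finset V} :
    IsMaxIndepFinset G S ↔ IsIndepFinset G S ∧ ∀ i ∉ S, ∃ j ∈ S, G.Adj i j := by
  refine and_congr_right fun hS => ⟨fun hmax i hi => ?_, fun hdom T hT hST => ?_⟩
  · by_contra! hnon
    refine hi ?_
    rw [hmax (insert i S) ?_ (subset_insert i S)]
    · exact mem_insert_self i S
    · intro a ha b hb hab
      rcases mem_insert.1 ha with rfl | haS <;> rcases mem_insert.1 hb with rfl | hbS
      · exact G.irrefl hab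
      · exact hnon b hbS hab
      · exact hnon a haS hab.symm
      · exact hS a haS b hbS hab
  · refine hST.antisymm fun i hi => ?_
    by_contra hiS
    obtain ⟨j, hj, hij⟩ := hdom i hiS
    exact hT i hi j (hST hj) hij

theorem adjMatrix_add_one_mulVec_apply {V : Type*} [Fintype V] [DecidableEq V]
    (G : SimpleGraph V) [DecidableRel G.Adj] (x : V → ℝ) (i : V) :
    ((G.adjMatrix ℝ + 1) *ᵥ x) i = ∑ j ∈ G.neighborFinset i, x j + x i := by
  rw [add_mulVec, one_mulVec, Pi.add_apply, SimpleGraph.adjMatrix_mulVec_apply]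

/-- A vector `x ∈ {0,1}ⁿ` solves `LCP(G)` if and only if `x` is the characteristic vector
of a maximal independent set of `G`. -/
theorem stmt_7 {n : ℕ} (G : SimpleGraph (Fin n)) [DecidableRel G.Adj]
    (x : Fin n → ℝ) (hbin : ∀ i, x i = 0 ∨ x i = 1) :
    SolLCP G x ↔ ∃ S : Finset (Fin n), IsMaxIndepFinset G S ∧
      ∀ i, x i = if i ∈ S then 1 else 0 := by
  simp only [SolLCP, adjMatrix_add_one_mulVec_apply, isMaxIndepFinset_iff]
  constructor
  · rintro ⟨hpos, hge, hcomp⟩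
    have hzero : ∀ i, x i * (∑ j ∈ G.neighborFinset i, x j + x i - 1) = 0 := fun i =>
      (sum_eq_zero_iff_of_nonneg fun i _ => mul_nonneg (hpos i) (sub_nonneg.2 (hge i))).1
        hcomp i (mem_univ i)
    refine ⟨univ.filter fun i => x i = 1, ⟨fun i hi j hj hij => ?_, fun i hi => ?_⟩, fun i => ?_⟩
    · have hi : x i = 1 := by simpa using hi
      have hj : x j = 1 := by simpa using hj
      have hle := single_le_sum (fun k _ => hpos k) ((G.mem_neighborFinset i j).2 hij)
      have := hzero i
      rw [hi] at this
      linarith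
    · have hi : x i = 0 := (hbin i).resolve_right (by simpa using hi)
      have hne : ∑ j ∈ G.neighborFinset i, x j ≠ 0 := by
        have := hge i
        intro h
        linarith
      obtain ⟨j, hj, hxj⟩ := exists_ne_zero_of_sum_ne_zero hne
      exact ⟨j, by simpa using (hbin j).resolve_left hxj, (G.mem_neighborFinset i j).1 hj⟩
    · rcases hbin i with h | h <;> simp [h]
  · rintro ⟨S, ⟨hind, hdom⟩, hx⟩
    have hpos : ∀ i, 0 ≤ x i := fun i => by rcases hbin i with h | h <;> simp [h]
    have hsum : ∀ i ∈ S, ∑ j ∈ G.neighborFinset i, x j = 0 := fun i hi =>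
      sum_eq_zero fun j hj => by
        rw [hx j, if_neg fun hjS => hind i hi j hjS ((G.mem_neighborFinset i j).1 hj)]
    refine ⟨hpos, fun i => ?_, sum_eq_zero fun i _ => ?_⟩
    · by_cases hi : i ∈ S
      · simp [hsum i hi, hx i, hi]
      · obtain ⟨j, hj, hij⟩ := hdom i hi
        have hle := single_le_sum (fun k _ => hpos k) ((G.mem_neighborFinset i j).2 hij)
        rw [hx j, if_pos hj] at hle
        linarith [hpos i]
    · by_cases hi : i ∈ S
      · simp [hsum i hi, hx i, hi]
      · simp [hx i, hi]
end

section
/- Let G be a finite simple graph and let x ∈ SOL(G). If S is a maximal independent set of G with S ⊆ σ(x) (the support of x), then eᵀx ≤ |S|. -/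
open Matrix Finset

theorem IsMaxIndepFinset.exists_eq_or_adj {V : Type*} [DecidableEq V] {G : SimpleGraph V}
    {S : Finset V} (hS : IsMaxIndepFinset G S) (v : V) : ∃ i ∈ S, i = v ∨ G.Adj i v := by
  by_contra! h
  have hv : v ∉ S := fun hv => (h v hv).1 rfl
  have hT : IsIndepFinset G (insert v S) := by
    intro i hi j hj hij
    rw [Finset.mem_insert] at hi hj
    rcases hi with rfl | hi <;> rcases hj with rfl | hj
    · exact G.irrefl hij
    · exact (h j hj).2 hij.symm
    · exact (h i hi).2 hij
    · exact hS.1 i hi j hj hij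
  exact hv (hS.2 _ hT (Finset.subset_insert v S) ▸ Finset.mem_insert_self v S)

theorem adjMatrix_add_one_nonneg {V : Type*} [DecidableEq V] (G : SimpleGraph V)
    [DecidableRel G.Adj] (i j : V) : 0 ≤ (G.adjMatrix ℝ + 1) i j := by
  rw [Matrix.add_apply, SimpleGraph.adjMatrix_apply, Matrix.one_apply]
  split_ifs <;> norm_num

theorem one_le_adjMatrix_add_one {V : Type*} [DecidableEq V] {G : SimpleGraph V}
    [DecidableRel G.Adj] {i j : V} (h : i = j ∨ G.Adj i j) : 1 ≤ (G.adjMatrix ℝ + 1) i j := by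
  rw [Matrix.add_apply, SimpleGraph.adjMatrix_apply, Matrix.one_apply]
  rcases h with h | h
  · simp [h]
  · simp [h, h.ne]

/-- If `x` solves `LCP(G)` and `S` is a maximal independent set of `G` contained in the
support `σ(x) = {i : x i > 0}`, then `eᵀx ≤ |S|`. -/
theorem stmt_8 {n : ℕ} (G : SimpleGraph (Fin n)) [DecidableRel G.Adj]
    (x : Fin n → ℝ) (hx : SolLCP G x)
    (S : Finset (Fin n)) (hS : IsMaxIndepFinset G S) (hsub : ∀ i ∈ S, 0 < x i) :
    ∑ i, x i ≤ (S.card : ℝ) := by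
  calc ∑ j, x j ≤ ∑ j, (∑ i ∈ S, (G.adjMatrix ℝ + 1) i j) * x j := by
        refine Finset.sum_le_sum fun j _ => le_mul_of_one_le_left (hx.1 j) ?_
        obtain ⟨i, hi, hij⟩ := hS.exists_eq_or_adj j
        exact (one_le_adjMatrix_add_one hij).trans
          (Finset.single_le_sum (f := fun i => (G.adjMatrix ℝ + 1) i j)
            (fun k _ => adjMatrix_add_one_nonneg G k j) hi)
    _ = ∑ i ∈ S, ((G.adjMatrix ℝ + 1) *ᵥ x) i := by
        simp only [Finset.sum_mul, Matrix.mulVec, dotProduct]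
        exact Finset.sum_comm
    _ = (S.card : ℝ) := by
        rw [Finset.sum_congr rfl fun i hi => hx.mulVec_eq_one (hsub i hi)]
        simp
end

section
/- Let G be a forest. If there exists x ∈ SOL(G) whose support is the entire vertex set of G (i.e. x_i > 0 for every vertex i), then every connected component of G is either a single vertex K₁ or a single edge K₂. -/
open Matrix Finset

/-- A solution of `LCP(G)` sums to one over the closed neighbourhood of each vertex of its
support. -/
theorem SolLCP.sum_neighborFinset_add_eq_one {V : Type*} [Fintype V] [DecidableEq V]
    {G : SimpleGraph V} [DecidableRel G.Adj] {x : V → ℝ} (hx : SolLCP G x) {i : V}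
    (hi : 0 < x i) : ∑ j ∈ G.neighborFinset i, x j + x i = 1 := by
  obtain ⟨h0, h1, h2⟩ := hx
  have h := (sum_eq_zero_iff_of_nonneg
    fun j _ => mul_nonneg (h0 j) (sub_nonneg.2 (h1 j))).1 h2 i (mem_univ i)
  have h' := (mul_eq_zero.1 h).resolve_left hi.ne'
  rw [add_mulVec, one_mulVec, Pi.add_apply, SimpleGraph.adjMatrix_mulVec_apply] at h'
  linarith

/-- If a solution of `LCP(G)` has full support, then the neighbour of a leaf is a leaf. -/
theorem SolLCP.neighborFinset_eq_singleton {V : Type*} [Fintype V] [DecidableEq V]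
    {G : SimpleGraph V} [DecidableRel G.Adj] {x : V → ℝ} (hx : SolLCP G x)
    (hsupp : ∀ i, 0 < x i) {u v : V} (hv : G.neighborFinset v = {u}) :
    G.neighborFinset u = {v} := by
  have hvu : v ∈ G.neighborFinset u := by
    have : u ∈ G.neighborFinset v := by simp [hv]
    simpa [G.adj_comm] using this
  have h1 := hx.sum_neighborFinset_add_eq_one (hsupp v)
  have h2 := hx.sum_neighborFinset_add_eq_one (hsupp u)
  rw [hv, sum_singleton] at h1
  rw [← add_sum_erase _ _ hvu] at h2
  refine subset_antisymm (fun w hw => ?_) (singleton_subset_iff.2 hvu)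
  by_contra hne
  have hw' : w ∈ (G.neighborFinset u).erase v := by simp_all
  have := single_le_sum (fun j _ => (hsupp j).le) hw'
  linarith [hsupp w]

/-- A set closed under adjacency contains every connected component it meets. -/
theorem SimpleGraph.ConnectedComponent.supp_subset_of_adj_closed {V : Type*} {G : SimpleGraph V}
    (c : G.ConnectedComponent) {s : Set V} (hs : ∀ u v, u ∈ s → G.Adj u v → v ∈ s) {a : V}
    (hac : a ∈ c.supp) (has : a ∈ s) : c.supp ⊆ s := by
  intro b hb
  obtain ⟨p⟩ := c.reachable_of_mem_supp hac hb
  clear hac hb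
  induction p with
  | nil => exact has
  | cons h _ ih => exact ih (hs _ _ has h)

/-- For a forest, every connected component with more than one vertex contains a vertex with
exactly one neighbour. -/
theorem SimpleGraph.IsAcyclic.exists_mem_supp_degree_eq_one {V : Type*} [Fintype V]
    {G : SimpleGraph V} [DecidableRel G.Adj] (hG : G.IsAcyclic) (c : G.ConnectedComponent)
    (hc : c.supp.Nontrivial) : ∃ v ∈ c.supp, G.degree v = 1 := by
  classical
  have : Nontrivial c.supp := hc.coe_sort
  obtain ⟨v, hv⟩ := IsTree.exists_vert_degree_one_of_nontrivial (G := G.induce c.supp)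
    (hG.isTree_connectedComponent c)
  refine ⟨v, v.2, ?_⟩
  rw [← hv]
  symm
  convert degree_induce_of_neighborSet_subset (G := G) (s := c.supp) (v := v)
    fun w hw => c.mem_supp_of_adj_mem_supp v.2 hw

/-- For a forest `G`, if some solution `x` of `LCP(G)` has full support (`x i > 0` for every
vertex `i`), then every connected component of `G` is a single vertex `K₁` or a single
edge `K₂`. -/
theorem stmt_10 {n : ℕ} (G : SimpleGraph (Fin n)) [DecidableRel G.Adj] (hG : G.IsAcyclic)
    (x : Fin n → ℝ) (hx : SolLCP G x) (hsupp : ∀ i, 0 < x i) :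
    ∀ c : G.ConnectedComponent, c.supp.ncard = 1 ∨
      (c.supp.ncard = 2 ∧ ∃ u ∈ c.supp, ∃ v ∈ c.supp, G.Adj u v) := by
  intro c
  rcases c.nonempty_supp.exists_eq_singleton_or_nontrivial with ⟨a, ha⟩ | hc
  · exact .inl (by simp [ha])
  obtain ⟨v, hvc, hv⟩ := hG.exists_mem_supp_degree_eq_one c hc
  obtain ⟨u, hu⟩ := card_eq_one.1 hv
  have hu' := hx.neighborFinset_eq_singleton hsupp hu
  have hvN : ∀ w, G.Adj v w ↔ w = u := fun w => by
    rw [← G.mem_neighborFinset, hu, mem_singleton]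
  have huN : ∀ w, G.Adj u w ↔ w = v := fun w => by
    rw [← G.mem_neighborFinset, hu', mem_singleton]
  have hvu : G.Adj v u := (hvN u).2 rfl
  have huc : u ∈ c.supp := c.mem_supp_of_adj_mem_supp hvc hvu
  have hsub : c.supp ⊆ {v, u} := by
    refine c.supp_subset_of_adj_closed ?_ hvc (by simp)
    rintro a b (rfl | rfl) hab
    · simp [(hvN b).1 hab]
    · simp [(huN b).1 hab]
  have heq : c.supp = {v, u} := hsub.antisymm (Set.pair_subset hvc huc)
  exact .inr ⟨by rw [heq, Set.ncard_pair hvu.ne], v, hvc, u, huc, hvu⟩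
end

section
/- Let G be a forest and x ∈ SOL(G). Then every connected component of the subgraph of G induced by the support σ(x) is either a single vertex K₁ or a single edge K₂. -/
open Matrix Finset

namespace SolLCP

variable {V : Type*} [Fintype V] [DecidableEq V] {G : SimpleGraph V} [DecidableRel G.Adj]
  {x : V → ℝ}

lemma add_sum_neighborFinset_eq_one (hx : SolLCP G x) {v : V} (hv : 0 < x v) :
    x v + ∑ u ∈ G.neighborFinset v, x u = 1 := by
  obtain ⟨h0, h1, h2⟩ := hx
  have h := (Finset.sum_eq_zero_iff_of_nonneg fun i _ =>
    mul_nonneg (h0 i) (sub_nonneg.2 (h1 i))).1 h2 v (Finset.mem_univ v)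
  have h' := (mul_eq_zero.1 h).resolve_left hv.ne'
  rw [Matrix.add_mulVec, Matrix.one_mulVec, Pi.add_apply,
    SimpleGraph.adjMatrix_mulVec_apply] at h'
  linarith

/-- In the support of a solution, the neighbor `p` of a leaf `v` has no other neighbor. -/
lemma eq_of_adj_of_adj_leaf (hx : SolLCP G x) {v p w : V} (hv : 0 < x v) (hp : 0 < x p)
    (hw : 0 < x w) (hvp : G.Adj v p) (hleaf : ∀ u, 0 < x u → G.Adj v u → u = p)
    (hpw : G.Adj p w) : w = v := by
  by_contra hwv
  have hsum : ∑ u ∈ G.neighborFinset v, x u = x p := by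
    refine Finset.sum_eq_single_of_mem p (by simpa using hvp) fun u hu hup => ?_
    rw [SimpleGraph.mem_neighborFinset] at hu
    by_contra hu0
    exact hup (hleaf u (lt_of_le_of_ne (hx.1 u) (Ne.symm hu0)) hu)
  have hle : x w + x v ≤ ∑ u ∈ G.neighborFinset p, x u := by
    rw [← Finset.sum_pair hwv]
    refine Finset.sum_le_sum_of_subset_of_nonneg ?_ fun i _ _ => hx.1 i
    simp [Finset.insert_subset_iff, hpw, hvp.symm]
  have h1 := hx.add_sum_neighborFinset_eq_one hv
  have h2 := hx.add_sum_neighborFinset_eq_one hp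
  linarith

end SolLCP

namespace SimpleGraph

variable {V : Type*} {G : SimpleGraph V}

lemma ConnectedComponent.supp_subset_of_adj_closed_s11 (c : G.ConnectedComponent) {s : Set V} {v : V}
    (hvc : v ∈ c.supp) (hvs : v ∈ s) (hs : ∀ a ∈ s, ∀ b, G.Adj a b → b ∈ s) : c.supp ⊆ s := by
  intro w hw
  obtain ⟨q⟩ := c.reachable_of_mem_supp hvc hw
  clear hvc hw
  induction q with
  | nil => exact hvs
  | cons h _ ih => exact ih (hs _ hvs _ h)

lemma IsAcyclic.exists_leaf_of_nontrivial_supp [Finite V] (hG : G.IsAcyclic)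
    (c : G.ConnectedComponent) (hc : c.supp.Nontrivial) :
    ∃ v ∈ c.supp, ∃ p, G.Adj v p ∧ ∀ w, G.Adj v w → w = p := by
  classical
  have : Nontrivial c := hc.coe_sort
  have : Fintype c := Fintype.ofFinite c
  have hT : c.toSimpleGraph.IsTree :=
    ⟨c.connected_toSimpleGraph, hG.induce c.supp⟩
  obtain ⟨⟨v, hv⟩, hdeg⟩ := hT.exists_vert_degree_one_of_nontrivial
  obtain ⟨⟨p, hp⟩, hvp, huniq⟩ := degree_eq_one_iff_existsUnique_adj.1 hdeg
  exact ⟨v, hv, p, hvp, fun w hw =>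
    congrArg Subtype.val (huniq ⟨w, c.mem_supp_of_adj_mem_supp hv hw⟩ hw)⟩

end SimpleGraph

open scoped Classical in
/-- For a forest `G` and a solution `x` of `LCP(G)`, every connected component of the
subgraph of `G` induced by the support `σ(x) = {i : x i > 0}` is a single vertex `K₁` or
a single edge `K₂`. -/
theorem stmt_11 {n : ℕ} (G : SimpleGraph (Fin n)) [DecidableRel G.Adj] (hG : G.IsAcyclic)
    (x : Fin n → ℝ) (hx : SolLCP G x) :
    ∀ c : (G.induce {i | 0 < x i}).ConnectedComponent, c.supp.ncard = 1 ∨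
      (c.supp.ncard = 2 ∧ ∃ u ∈ c.supp, ∃ v ∈ c.supp, (G.induce {i | 0 < x i}).Adj u v) := by
  intro c
  obtain hsub | hnt := c.supp.subsingleton_or_nontrivial
  · left
    obtain ⟨a, ha⟩ := c.nonempty_supp
    rw [Set.ncard_eq_one]
    exact ⟨a, hsub.eq_singleton_of_mem ha⟩
  · right
    obtain ⟨v, hv, p, hvp, hleaf⟩ := (hG.induce _).exists_leaf_of_nontrivial_supp c hnt
    have hp : p ∈ c.supp := c.mem_supp_of_adj_mem_supp hv hvp
    have hpair : c.supp = {v, p} := by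
      refine (c.supp_subset_of_adj_closed_s11 hv (by simp) ?_).antisymm
        (Set.insert_subset hv (Set.singleton_subset_iff.2 hp))
      rintro a (rfl | rfl) b hab
      · exact Or.inr (hleaf b hab)
      · refine Or.inl (Subtype.ext ?_)
        exact hx.eq_of_adj_of_adj_leaf v.2 a.2 b.2 hvp
          (fun u hu h => congrArg Subtype.val (hleaf ⟨u, hu⟩ h)) hab
    refine ⟨?_, v, hv, p, hp, hvp⟩
    rw [hpair, Set.ncard_pair hvp.ne]
end

section
/- For a d-regular simple graph G on n vertices with adjacency matrix A, the minimum ℓ₁ norm over solutions of LCP(G) equals n/(d+1); that is, min{ eᵀx : x ∈ SOL(G) } = n/(d+1). -/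
open Matrix Finset

theorem SimpleGraph.IsRegularOfDegree.adjMatrix_add_one_mulVec_const {V : Type*} [Fintype V]
    [DecidableEq V] {G : SimpleGraph V} [DecidableRel G.Adj] {d : ℕ}
    (hreg : G.IsRegularOfDegree d) (a : ℝ) (i : V) :
    ((G.adjMatrix ℝ + 1) *ᵥ fun _ => a) i = (d + 1) * a := by
  have h := SimpleGraph.adjMatrix_mulVec_const_apply_of_regular (α := ℝ) (a := a) hreg (v := i)
  rw [add_mulVec, one_mulVec, Pi.add_apply, show (fun _ => a) = Function.const V a from rfl, h]
  ring

theorem SimpleGraph.IsRegularOfDegree.sum_adjMatrix_add_one_mulVec {V : Type*} [Fintype V]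
    [DecidableEq V] {G : SimpleGraph V} [DecidableRel G.Adj] {d : ℕ}
    (hreg : G.IsRegularOfDegree d) (x : V → ℝ) :
    ∑ i, ((G.adjMatrix ℝ + 1) *ᵥ x) i = (d + 1) * ∑ i, x i := by
  have hsymm : (G.adjMatrix ℝ + 1)ᵀ = G.adjMatrix ℝ + 1 := by simp
  calc ∑ i, ((G.adjMatrix ℝ + 1) *ᵥ x) i
      = (fun _ => (1 : ℝ)) ⬝ᵥ ((G.adjMatrix ℝ + 1) *ᵥ x) := by simp [dotProduct]
    _ = ((G.adjMatrix ℝ + 1) *ᵥ fun _ => (1 : ℝ)) ⬝ᵥ x := by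
        rw [dotProduct_mulVec, ← mulVec_transpose, hsymm]
    _ = (d + 1) * ∑ i, x i := by
        simp only [dotProduct, hreg.adjMatrix_add_one_mulVec_const, mul_one, ← Finset.mul_sum]

/-- For a `d`-regular simple graph `G` on `n` vertices, the minimum of `eᵀx` over all
solutions of `LCP(A+I, -e)` equals `n/(d+1)`. -/
theorem stmt_13 {n d : ℕ} (G : SimpleGraph (Fin n)) [DecidableRel G.Adj]
    (hreg : G.IsRegularOfDegree d) :
    IsLeast {v : ℝ | ∃ x : Fin n → ℝ, SolLCP G x ∧ v = ∑ i, x i} ((n : ℝ) / (d + 1)) := by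
  have hd : (0 : ℝ) < d + 1 := by positivity
  constructor
  · have h (i : Fin n) : ((G.adjMatrix ℝ + 1) *ᵥ fun _ => 1 / ((d : ℝ) + 1)) i = 1 := by
      rw [hreg.adjMatrix_add_one_mulVec_const, mul_one_div_cancel hd.ne']
    refine ⟨fun _ => 1 / ((d : ℝ) + 1), ⟨fun _ => by positivity, fun i => (h i).ge, ?_⟩, ?_⟩
    · simp only [h, sub_self, mul_zero, Finset.sum_const_zero]
    · simp [div_eq_mul_inv]
  · rintro v ⟨x, ⟨-, hx, -⟩, rfl⟩
    rw [div_le_iff₀' hd, ← hreg.sum_adjMatrix_add_one_mulVec]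
    simpa using Finset.sum_le_sum fun i (_ : i ∈ Finset.univ) => hx i
end

section
/- For a finite simple graph G on n vertices with adjacency matrix A and diagonal degree matrix D, a vector x ∈ {0,1}^n solves LCP(G) if and only if 0 ≤ (A+I)x − e ≤ (D−I)(e−x) (both inequalities entrywise). -/
open Matrix Finset

/-- If every entry of `x` is at most `1`, then `((A+I)x) i` is at most `deg i + x i`. -/
theorem adjMatrix_add_one_mulVec_le {V : Type*} [Fintype V] [DecidableEq V]
    (G : SimpleGraph V) [DecidableRel G.Adj] (x : V → ℝ) (hx : ∀ i, x i ≤ 1) (i : V) :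
    ((G.adjMatrix ℝ + 1) *ᵥ x) i ≤ G.degree i + x i := by
  rw [Matrix.add_mulVec, Matrix.one_mulVec, Pi.add_apply, SimpleGraph.adjMatrix_mulVec_apply]
  have := Finset.sum_le_card_nsmul (G.neighborFinset i) x 1 fun j _ => hx j
  simpa using this

/-- A vector `x ∈ {0,1}ⁿ` solves `LCP(G)` if and only if
`0 ≤ (A+I)x − e ≤ (D−I)(e−x)` entrywise, where `A` is the adjacency matrix and `D` the
diagonal matrix of vertex degrees of `G`. -/
theorem stmt_16 {n : ℕ} (G : SimpleGraph (Fin n)) [DecidableRel G.Adj]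
    (x : Fin n → ℝ) (hbin : ∀ i, x i = 0 ∨ x i = 1) :
    SolLCP G x ↔ ∀ i,
      0 ≤ ((G.adjMatrix ℝ + 1) *ᵥ x) i - 1 ∧
      ((G.adjMatrix ℝ + 1) *ᵥ x) i - 1 ≤
        ((Matrix.diagonal (fun j => (G.degree j : ℝ)) - 1) *ᵥ (fun j => 1 - x j)) i := by
  have hrhs (i : Fin n) :
      ((Matrix.diagonal (fun j => (G.degree j : ℝ)) - 1) *ᵥ (fun j => 1 - x j)) i =
        ((G.degree i : ℝ) - 1) * (1 - x i) := by
    rw [Matrix.sub_mulVec, Matrix.one_mulVec, Pi.sub_apply, Matrix.mulVec_diagonal]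
    ring
  have hx0 (i : Fin n) : 0 ≤ x i := by rcases hbin i with h | h <;> simp [h]
  constructor
  · rintro ⟨-, hge, hsum⟩ i
    refine ⟨sub_nonneg.2 (hge i), ?_⟩
    rw [hrhs]
    rcases hbin i with h | h
    · have := adjMatrix_add_one_mulVec_le G x
        (fun j => by rcases hbin j with h | h <;> simp [h]) i
      rw [h] at this ⊢
      linarith
    · have hi := (Finset.sum_eq_zero_iff_of_nonneg
        (fun j _ => mul_nonneg (hx0 j) (sub_nonneg.2 (hge j)))).1 hsum i (Finset.mem_univ i)
      rw [h, one_mul] at hi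
      rw [hi, h]
      simp
  · intro hbd
    refine ⟨hx0, fun i => sub_nonneg.1 (hbd i).1, Finset.sum_eq_zero fun i _ => ?_⟩
    obtain ⟨hlo, hhi⟩ := hbd i
    rw [hrhs] at hhi
    rcases hbin i with h | h
    · rw [h, zero_mul]
    · rw [h, sub_self, mul_zero] at hhi
      rw [le_antisymm hhi hlo, mul_zero]
end
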